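/- (Multiple-depot lower bound.) Let (X, d) be a metric space, S ⊆ X a nonempty finite set of depots, Q an integer capacity ≥ 1, Z ⊆ X a finite set of clients disjoint from S, and ρ : Z → ℕ demands with 1 ≤ ρ(c) ≤ Q. A feasible multiple-depot solution is a finite collection of tours, each a finite list v₀, c₁, …, c_m, v_{m+1} with v₀, v_{m+1} ∈ S and all cᵢ ∈ Z, such that every client of Z appears in exactly one tour exactly once and the total demand on each tour is at most Q. Then every feasible multiple-depot solution has cost (sum of tour lengths) at least (1/Q) · Σ_{c ∈ Z} d(c, S), where d(c, S) = min_{s ∈ S} d(c, s). -/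

import Mathlib

/-- The length of a path visiting the given list of points, under metric `d`:
the sum of distances between consecutive points. -/
def pathLength {X : Type*} (d : X → X → ℝ) : List X → ℝ
  | [] => 0
  | [_] => 0
  | x :: y :: rest => d x y + pathLength d (y :: rest)

/-- A multiple-depot tour: a starting depot, the ordered list of visited
clients, and an ending depot. -/
def mdTourLength {X : Type*} [MetricSpace X] (t : X × List X × X) : ℝ :=
  pathLength dist (t.1 :: (t.2.1 ++ [t.2.2]))

/-- Feasibility of a collection of multiple-depot tours: every tour starts and
ends at a depot in `S`, every point on a tour is a client, every client appears
exactly once over all tours, and each tour covers at most `Q` units of demand. -/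
def FeasibleMDCVR {X : Type*} [DecidableEq X]
    (S : Finset X) (Z : Finset X) (ρ : X → ℕ) (Q : ℕ)
    (tours : List (X × List X × X)) : Prop :=
  (∀ t ∈ tours, t.1 ∈ S ∧ t.2.2 ∈ S ∧ ∀ c ∈ t.2.1, c ∈ Z) ∧
  (∀ c ∈ Z, (tours.flatMap (fun t => t.2.1)).count c = 1) ∧
  (∀ t ∈ tours, (t.2.1.map ρ).sum ≤ Q)

theorem pathLength_dist_nonneg {X : Type*} [PseudoMetricSpace X] (l : List X) :
    0 ≤ pathLength dist l := by
  induction l with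
  | nil => exact le_rfl
  | cons a l ih =>
    cases l with
    | nil => exact le_rfl
    | cons b l => exact add_nonneg dist_nonneg ih

/-- A path is at least as long as the distance from its first point to any later point. -/
theorem dist_le_pathLength {X : Type*} [PseudoMetricSpace X] {l : List X} {a c : X}
    (hc : c ∈ l) : dist a c ≤ pathLength dist (a :: l) := by
  induction l generalizing a with
  | nil => simp at hc
  | cons b l ih =>
    rw [pathLength]
    rcases List.mem_cons.1 hc with rfl | hc
    · exact le_add_of_nonneg_right (pathLength_dist_nonneg _)
    · exact (dist_triangle a b c).trans (add_le_add_right (ih hc) _)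

theorem infDist_le_mdTourLength {X : Type*} [MetricSpace X] {S : Set X} {t : X × List X × X}
    (ht : t.1 ∈ S) {c : X} (hc : c ∈ t.2.1) : Metric.infDist c S ≤ mdTourLength t :=
  calc Metric.infDist c S ≤ dist c t.1 := Metric.infDist_le_dist_of_mem ht
    _ = dist t.1 c := dist_comm _ _
    _ ≤ mdTourLength t := dist_le_pathLength (List.mem_append_left _ hc)

/-- A tour whose clients have positive demands of total at most `Q` visits at most `Q` clients,
each of which is no farther from the depots than the length of the tour. -/
theorem sum_infDist_le_mul_mdTourLength {X : Type*} [MetricSpace X] {S : Set X}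
    {ρ : X → ℕ} {Q : ℕ} {t : X × List X × X} (ht : t.1 ∈ S) (hρ : ∀ c ∈ t.2.1, 1 ≤ ρ c)
    (hQ : (t.2.1.map ρ).sum ≤ Q) :
    (t.2.1.map fun c => Metric.infDist c S).sum ≤ Q * mdTourLength t := by
  have hlen : t.2.1.length ≤ Q := by
    have h := List.card_nsmul_le_sum (t.2.1.map ρ) 1 (by simpa using hρ)
    simp only [List.length_map, smul_eq_mul, mul_one] at h
    exact h.trans hQ
  have hsum := List.sum_le_card_nsmul (t.2.1.map fun c => Metric.infDist c S) (mdTourLength t)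
    (by simpa using fun c hc => infDist_le_mdTourLength ht hc)
  rw [List.length_map, nsmul_eq_mul] at hsum
  exact hsum.trans (mul_le_mul_of_nonneg_right (by exact_mod_cast hlen)
    (pathLength_dist_nonneg _))

theorem multiple_depot_lower_bound {X : Type*} [MetricSpace X] [DecidableEq X]
    (S : Finset X) (hS : S.Nonempty)
    (Q : ℕ) (hQ : 1 ≤ Q)
    (Z : Finset X) (hZS : ∀ c ∈ Z, c ∉ S)
    (ρ : X → ℕ) (hρ : ∀ c ∈ Z, 1 ≤ ρ c ∧ ρ c ≤ Q)
    (tours : List (X × List X × X)) (hfeas : FeasibleMDCVR S Z ρ Q tours) :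
    (1 / (Q : ℝ)) * ∑ c ∈ Z, Metric.infDist c (S : Set X) ≤
      (tours.map mdTourLength).sum := by
  obtain ⟨htour, hcount, hcap⟩ := hfeas
  have hZ : (tours.flatMap fun t => t.2.1).toFinset = Z := by
    ext c
    rw [List.mem_toFinset]
    refine ⟨fun hc => ?_, fun hc => List.count_pos_iff.1 (by rw [hcount c hc]; exact one_pos)⟩
    obtain ⟨t, ht, hct⟩ := List.mem_flatMap.1 hc
    exact (htour t ht).2.2 c hct
  have hsum : ∑ c ∈ Z, Metric.infDist c (S : Set X) =
      (tours.map fun t => (t.2.1.map fun c => Metric.infDist c (S : Set X)).sum).sum := by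
    have h := Finset.sum_list_map_count (tours.flatMap fun t => t.2.1)
      fun c => Metric.infDist c (S : Set X)
    rw [hZ, Finset.sum_congr rfl fun c hc => by rw [hcount c hc, one_smul]] at h
    rw [← h, List.map_flatMap, List.flatMap, List.sum_flatten, List.map_map]
    rfl
  rw [one_div, inv_mul_le_iff₀ (by exact_mod_cast hQ), hsum, ← List.sum_map_mul_left]
  exact List.sum_le_sum fun t ht => sum_infDist_le_mul_mdTourLength (htour t ht).1
    (fun c hc => (hρ c ((htour t ht).2.2 c hc)).1) (hcap t ht)
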